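/- For every real c with (85−14√10)/585 ≤ c < (9−2√2)/73, set a = (c + √(2c − 9c²))/2 and b = (1 − 4c − √(2c − 9c²))/4. Then the 9×9 diagonal matrix diag(a, a, b, b, b, b, c, c, c) is an extreme point of AP_{3,3}. -/

import Mathlib

open Matrix ComplexOrder

noncomputable section

/-- Index type for a two-qutrit system. -/
abbrev QIdx : Type := Fin 3 × Fin 3

/-- Partial transpose: `PT M ((i,j),(k,l)) = M ((i,l),(k,j))`. -/
def PT (M : Matrix QIdx QIdx ℂ) : Matrix QIdx QIdx ℂ :=
  fun p q => M (p.1, q.2) (q.1, p.2)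

/-- The set of absolutely PPT two-qutrit states. -/
def AP33 : Set (Matrix QIdx QIdx ℂ) :=
  {ρ | ρ.PosSemidef ∧ ρ.trace = 1 ∧
    ∀ U : Matrix QIdx QIdx ℂ, U ∈ Matrix.unitaryGroup QIdx ℂ →
      (PT (U * ρ * Uᴴ)).PosSemidef}

/-- The 9×9 diagonal matrix with prescribed real diagonal entries
(listed in order), regarded as a matrix indexed by `QIdx`. -/
def diag9 (d : Fin 9 → ℝ) : Matrix QIdx QIdx ℂ :=
  Matrix.diagonal fun p => ((d ((finProdFinEquiv.trans (finCongr (by norm_num))) p) : ℝ) : ℂ)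

/-- Singular value decomposition of a square complex matrix. -/
theorem exists_singular_value_decomposition {k : ℕ} (A : Matrix (Fin k) (Fin k) ℂ) :
    ∃ W ∈ Matrix.unitaryGroup (Fin k) ℂ, ∃ V ∈ Matrix.unitaryGroup (Fin k) ℂ, ∃ d : Fin k → ℝ,
      (∀ i, 0 ≤ d i) ∧ A = W * Matrix.diagonal (fun i => (d i : ℂ)) * V := by
  have hH : (Aᴴ * A).IsHermitian := isHermitian_conjTranspose_mul_self A
  let V : Matrix (Fin k) (Fin k) ℂ := (hH.eigenvectorUnitary : Matrix (Fin k) (Fin k) ℂ)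
  have hVu : V ∈ Matrix.unitaryGroup (Fin k) ℂ := hH.eigenvectorUnitary.2
  have hdiag : (A * V)ᴴ * (A * V) = Matrix.diagonal (fun i => (hH.eigenvalues i : ℂ)) := by
    have h := hH.conjStarAlgAut_star_eigenvectorUnitary
    rw [Unitary.conjStarAlgAut_star_apply] at h
    rw [conjTranspose_mul, Matrix.mul_assoc, ← Matrix.mul_assoc Aᴴ, ← Matrix.mul_assoc]
    exact h
  let f : Fin k → EuclideanSpace ℂ (Fin k) := fun j => WithLp.toLp 2 fun i => (A * V) i j
  have hinner : ∀ i j, inner ℂ (f i) (f j) = ((A * V)ᴴ * (A * V)) i j := by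
    intro i j
    rw [Matrix.mul_apply]
    simp [f, PiLp.inner_apply, mul_comm]
  have hf : Pairwise fun i j => inner ℂ (f i) (f j) = 0 := by
    intro i j hij
    simp only [hinner, hdiag]
    exact Matrix.diagonal_apply_ne _ hij
  let b := InnerProductSpace.gramSchmidtOrthonormalBasis (𝕜 := ℂ)
    (by simp : Module.finrank ℂ (EuclideanSpace ℂ (Fin k)) = Fintype.card (Fin k)) f
  have hb : ∀ i, f i = (‖f i‖ : ℂ) • b i := by
    intro i
    by_cases hi : f i = 0
    · simp [hi]
    · rw [InnerProductSpace.gramSchmidtOrthonormalBasis_apply_of_orthogonal _ hf hi, smul_smul]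
      have : (‖f i‖ : ℂ) ≠ 0 := by simpa using hi
      simp [this]
  have hWu : (Matrix.of fun p i => b i p) ∈ Matrix.unitaryGroup (Fin k) ℂ := by
    rw [Matrix.mem_unitaryGroup_iff']
    ext i j
    have := orthonormal_iff_ite.mp b.orthonormal i j
    rw [Matrix.one_apply, ← this]
    simp [Matrix.mul_apply, PiLp.inner_apply, mul_comm, star_eq_conjTranspose]
  refine ⟨_, hWu, Vᴴ, ?_, fun i => ‖f i‖, fun i => norm_nonneg _, ?_⟩
  · exact Unitary.star_mem hVu
  · have hAV : A * V = (Matrix.of fun p i => b i p) * Matrix.diagonal (fun i => (‖f i‖ : ℂ)) := by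
      ext p i
      have := congrArg (fun v : EuclideanSpace ℂ (Fin k) => v p) (hb i)
      simp only [PiLp.smul_apply, smul_eq_mul] at this
      rw [Matrix.mul_diagonal, Matrix.of_apply, mul_comm, ← this]
    rw [← hAV, Matrix.mul_assoc, ← star_eq_conjTranspose, Matrix.mem_unitaryGroup_iff.mp hVu,
      Matrix.mul_one]

theorem kronecker_conjTranspose_mem_unitaryGroup {m n : Type*} [Fintype m] [DecidableEq m]
    [Fintype n] [DecidableEq n] {A : Matrix m m ℂ} {B : Matrix n n ℂ}
    (hA : A ∈ Matrix.unitaryGroup m ℂ) (hB : B ∈ Matrix.unitaryGroup n ℂ) :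
    kroneckerMap (· * ·) A Bᴴ ∈ Matrix.unitaryGroup (m × n) ℂ :=
  Matrix.kronecker_mem_unitary hA (Unitary.star_mem hB)

/-- Local unitaries bring the quadratic form of a partial transpose to Schmidt form. -/
theorem quadForm_PT_eq (M : Matrix QIdx QIdx ℂ) (A B : Matrix (Fin 3) (Fin 3) ℂ) (d : Fin 3 → ℝ) :
    (star fun p : QIdx => (A * Matrix.diagonal (fun i => (d i : ℂ)) * B) p.1 p.2) ⬝ᵥ
        (PT M *ᵥ fun p : QIdx => (A * Matrix.diagonal (fun i => (d i : ℂ)) * B) p.1 p.2) =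
      ∑ s, ∑ t, (d s : ℂ) * d t *
        ((kroneckerMap (· * ·) A Bᴴ)ᴴ * M * kroneckerMap (· * ·) A Bᴴ) (s, t) (t, s) := by
  let T : Fin 3 → Fin 3 → Fin 3 → Fin 3 → Fin 3 → Fin 3 → ℂ := fun i j k l s t =>
    d s * d t * star (A i s) * star (B s j) * M (i, l) (k, j) * A k t * B t l
  have hL : ∀ p : QIdx, (A * Matrix.diagonal (fun i => (d i : ℂ)) * B) p.1 p.2 =
      ∑ s, A p.1 s * d s * B s p.2 := fun p => by
    simp only [Matrix.mul_apply (M := A * _), Matrix.mul_diagonal]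
  calc _ = ∑ i, ∑ j, ∑ k, ∑ l, ∑ s, ∑ t, T i j k l s t := by
        simp only [dotProduct, mulVec, hL, Pi.star_apply, star_sum, Fintype.sum_prod_type, PT,
          Finset.mul_sum, Finset.sum_mul, T]
        refine Finset.sum_congr rfl fun i _ => Finset.sum_congr rfl fun j _ =>
          Finset.sum_congr rfl fun k _ => Finset.sum_congr rfl fun l _ => ?_
        rw [Finset.sum_comm]
        refine Finset.sum_congr rfl fun s _ => Finset.sum_congr rfl fun t _ => ?_
        simp only [star_mul', Complex.star_def, Complex.conj_ofReal]
        ring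
    _ = ∑ s, ∑ t, ∑ k, ∑ j, ∑ i, ∑ l, T i j k l s t := by
        simp only [← Fintype.sum_prod_type']
        let e : Fin 3 × Fin 3 × Fin 3 × Fin 3 × Fin 3 × Fin 3 ≃
            Fin 3 × Fin 3 × Fin 3 × Fin 3 × Fin 3 × Fin 3 :=
          { toFun := fun x => (x.2.2.2.2.1, x.2.2.2.2.2, x.2.2.1, x.2.1, x.1, x.2.2.2.1)
            invFun := fun y => (y.2.2.2.2.1, y.2.2.2.1, y.2.2.1, y.2.2.2.2.2, y.1, y.2.1)
            left_inv := fun _ => rfl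
            right_inv := fun _ => rfl }
        exact Fintype.sum_equiv e _ _ fun _ => rfl
    _ = _ := by
        refine Finset.sum_congr rfl fun s _ => Finset.sum_congr rfl fun t _ => ?_
        simp only [Matrix.mul_apply, Fintype.sum_prod_type, Finset.mul_sum, Finset.sum_mul,
          kroneckerMap_apply, conjTranspose_apply, T]
        refine Finset.sum_congr rfl fun i _ => Finset.sum_congr rfl fun j _ =>
          Finset.sum_congr rfl fun k _ => Finset.sum_congr rfl fun l _ => ?_
        simp only [star_mul', star_star]
        ring

/-- The quadratic form of a partial transpose at a vector in Schmidt form. -/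
def schmidtForm (d : Fin 3 → ℝ) (M : Matrix QIdx QIdx ℂ) : ℝ :=
  ∑ s, ∑ t, d s * d t * (M (s, t) (t, s)).re

theorem Matrix.PosSemidef.abs_re_offdiag_le {n : Type*} [Fintype n] [DecidableEq n]
    {M : Matrix n n ℂ} (hM : M.PosSemidef) (p q : n) :
    |(M p q).re + (M q p).re| ≤ (M p p).re + (M q q).re := by
  have h1 := hM.dotProduct_mulVec_nonneg (Pi.single p 1 + Pi.single q 1)
  have h2 := hM.dotProduct_mulVec_nonneg (Pi.single p 1 - Pi.single q 1)
  have hs : ∀ i : n, star (Pi.single i 1 : n → ℂ) = Pi.single i 1 := fun i => by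
    rw [← Pi.single_star, star_one]
  simp only [star_add, star_sub, hs, mulVec_add, mulVec_sub, add_dotProduct, sub_dotProduct,
    dotProduct_add, dotProduct_sub, single_one_dotProduct, mulVec_single_one, col_apply] at h1 h2
  have h1' := (Complex.le_def.mp h1).1
  have h2' := (Complex.le_def.mp h2).1
  simp only [Complex.zero_re, Complex.add_re, Complex.sub_re] at h1' h2'
  rw [abs_le]
  constructor <;> linarith

/-- For `0 ≤ M ≤ 1`, the Schmidt form of `M` is a combination, with weights in `[0, 1]` of total
mass `tr M`, of the eigenvalues of the partial transpose of a pure state. -/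
theorem exists_weights_schmidtForm {M : Matrix QIdx QIdx ℂ} (hM : M.PosSemidef)
    (hM' : (1 - M).PosSemidef) (d : Fin 3 → ℝ) :
    ∃ m p q : Fin 3 → ℝ, (∀ i, 0 ≤ m i ∧ m i ≤ 1) ∧ (∀ i, 0 ≤ p i ∧ p i ≤ 1) ∧
      (∀ i, 0 ≤ q i ∧ q i ≤ 1) ∧ M.trace.re = ∑ i, (m i + p i + q i) ∧
      schmidtForm d M = d 0 ^ 2 * m 0 + d 1 ^ 2 * m 1 + d 2 ^ 2 * m 2 +
        d 0 * d 1 * (p 0 - q 0) + d 0 * d 2 * (p 1 - q 1) + d 1 * d 2 * (p 2 - q 2) := by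
  let x : Fin 3 → Fin 3 := ![0, 0, 1]
  let y : Fin 3 → Fin 3 := ![1, 2, 2]
  let A : Fin 3 → ℝ := fun i => (M (x i, y i) (x i, y i)).re + (M (y i, x i) (y i, x i)).re
  let e : Fin 3 → ℝ := fun i => (M (x i, y i) (y i, x i)).re + (M (y i, x i) (x i, y i)).re
  have hxy : ∀ i, x i ≠ y i := by decide
  have he : ∀ i, |e i| ≤ A i := fun i => hM.abs_re_offdiag_le _ _
  have he' : ∀ i, |e i| ≤ 2 - A i := fun i => by
    have h := hM'.abs_re_offdiag_le (x i, y i) (y i, x i)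
    have h1 : ((x i, y i) : QIdx) ≠ (y i, x i) := fun h => hxy i (congrArg Prod.fst h)
    simp only [Matrix.sub_apply, Matrix.one_apply_eq, Matrix.one_apply_ne h1,
      Matrix.one_apply_ne h1.symm, Complex.sub_re, Complex.one_re, Complex.zero_re] at h
    rw [← abs_neg]
    convert h using 1
    · congr 1
      simp only [e]
      ring
    · simp only [A]
      ring
  have hm : ∀ p, 0 ≤ (M p p).re := fun p => (Complex.le_def.mp (hM.diag_nonneg (i := p))).1
  have hm' : ∀ p, (M p p).re ≤ 1 := fun p => by
    have := (Complex.le_def.mp (hM'.diag_nonneg (i := p))).1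
    simpa using this
  refine ⟨fun i => (M (i, i) (i, i)).re, fun i => (A i + e i) / 2, fun i => (A i - e i) / 2,
    fun i => ⟨hm _, hm' _⟩, fun i => ?_, fun i => ?_, ?_, ?_⟩
  · have := abs_le.mp (he i)
    have := abs_le.mp (he' i)
    constructor <;> linarith
  · have := abs_le.mp (he i)
    have := abs_le.mp (he' i)
    constructor <;> linarith
  · simp [Matrix.trace, Fintype.sum_prod_type, Fin.sum_univ_three, A, x, y]
    ring
  · simp [schmidtForm, Fin.sum_univ_three, A, e, x, y]
    ring

theorem schmidtForm_ge_of_trace_eq_two {M : Matrix QIdx QIdx ℂ} (hM : M.PosSemidef)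
    (hM' : (1 - M).PosSemidef) (ht : M.trace.re = 2) {d : Fin 3 → ℝ}
    (h2 : 0 ≤ d 2) (h21 : d 2 ≤ d 1) (h10 : d 1 ≤ d 0) :
    -(d 0 * d 1) - d 0 * d 2 ≤ schmidtForm d M := by
  obtain ⟨m, p, q, hm, hp, hq, hs, h⟩ := exists_weights_schmidtForm hM hM' d
  rw [h]
  rw [ht] at hs
  simp only [Fin.sum_univ_three] at hs
  generalize d 0 = x at *
  generalize d 1 = y at *
  generalize d 2 = z at *
  have hy : 0 ≤ y := h2.trans h21
  have hx : 0 ≤ x := hy.trans h10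
  have hxz : 0 ≤ x * z := mul_nonneg hx h2
  have hxy : 0 ≤ x * y := mul_nonneg hx hy
  have hyz : 0 ≤ y * z := mul_nonneg hy h2
  have hc : x * z * 2 = x * z * (m 0 + p 0 + q 0 + (m 1 + p 1 + q 1) + (m 2 + p 2 + q 2)) := by
    rw [hs]
  linear_combination
    mul_nonneg (add_nonneg (sq_nonneg x) hxz) (hm 0).1 +
    mul_nonneg (add_nonneg (sq_nonneg y) hxz) (hm 1).1 +
    mul_nonneg (add_nonneg (sq_nonneg z) hxz) (hm 2).1 +
    mul_nonneg (add_nonneg hxy hxz) (hp 0).1 +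
    mul_nonneg (mul_nonneg hx (sub_nonneg.mpr h21)) (sub_nonneg.mpr (hq 0).2) +
    mul_nonneg (add_nonneg hxz hxz) (hp 1).1 +
    mul_nonneg (add_nonneg hyz hxz) (hp 2).1 +
    mul_nonneg (mul_nonneg (sub_nonneg.mpr h10) h2) (hq 2).1 - hc

theorem schmidtForm_le_of_trace_eq_three {M : Matrix QIdx QIdx ℂ} (hM : M.PosSemidef)
    (hM' : (1 - M).PosSemidef) (ht : M.trace.re = 3) {d : Fin 3 → ℝ}
    (h2 : 0 ≤ d 2) (h21 : d 2 ≤ d 1) (h10 : d 1 ≤ d 0) :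
    schmidtForm d M ≤ d 0 ^ 2 + d 0 * d 1 + max (d 0 * d 2) (d 1 ^ 2) := by
  obtain ⟨m, p, q, hm, hp, hq, hs, h⟩ := exists_weights_schmidtForm hM hM' d
  rw [h]
  rw [ht] at hs
  simp only [Fin.sum_univ_three] at hs
  generalize d 0 = x at *
  generalize d 1 = y at *
  generalize d 2 = z at *
  have hy : 0 ≤ y := h2.trans h21
  have hx : 0 ≤ x := hy.trans h10
  have hxz : 0 ≤ x * z := mul_nonneg hx h2
  have hxy : 0 ≤ x * y := mul_nonneg hx hy
  have hyz : 0 ≤ y * z := mul_nonneg hy h2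
  have t1 : x * z ≤ max (x * z) (y ^ 2) := le_max_left _ _
  have t2 : y ^ 2 ≤ max (x * z) (y ^ 2) := le_max_right _ _
  have t3 : max (x * z) (y ^ 2) ≤ x * y := max_le (by nlinarith) (by nlinarith)
  have t4 : max (x * z) (y ^ 2) ≤ x ^ 2 := t3.trans (by nlinarith)
  have t5 : z ^ 2 ≤ y ^ 2 := by nlinarith
  have t6 : y * z ≤ x * z := by nlinarith
  generalize max (x * z) (y ^ 2) = t at *
  have hc : t * 3 = t * (m 0 + p 0 + q 0 + (m 1 + p 1 + q 1) + (m 2 + p 2 + q 2)) := by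
    rw [hs]
  linear_combination
    mul_nonneg (sub_nonneg.mpr t4) (sub_nonneg.mpr (hm 0).2) +
    mul_nonneg (sub_nonneg.mpr t2) (hm 1).1 +
    mul_nonneg (sub_nonneg.mpr (t5.trans t2)) (hm 2).1 +
    mul_nonneg (sub_nonneg.mpr t3) (sub_nonneg.mpr (hp 0).2) +
    mul_nonneg (add_nonneg hxy (hxz.trans t1)) (hq 0).1 +
    mul_nonneg (sub_nonneg.mpr t1) (hp 1).1 +
    mul_nonneg (add_nonneg hxz (hxz.trans t1)) (hq 1).1 +
    mul_nonneg (sub_nonneg.mpr (t6.trans t1)) (hp 2).1 +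
    mul_nonneg (add_nonneg hyz (hxz.trans t1)) (hq 2).1 - hc

/-- Labels the three eigenspaces of the state. -/
def blockIdx (p : QIdx) : Fin 3 := ![![0, 0, 1], ![1, 1, 1], ![2, 2, 2]] p.1 p.2

/-- The distinct eigenvalues `a, b, c` of the state, in terms of `c` and `r = (a - c) / c`. -/
def blockEig (r c : ℝ) : Fin 3 → ℝ := ![(1 + r) * c, r ^ 2 / 2 * c, c]

/-- The diagonal state with eigenvalues `blockEig r c`. -/
def blockState (r c : ℝ) : Matrix QIdx QIdx ℂ :=
  Matrix.diagonal fun p => (blockEig r c (blockIdx p) : ℂ)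

/-- The orthogonal projection onto an eigenspace of `blockState`. -/
def blockProj (k : Fin 3) : Matrix QIdx QIdx ℂ :=
  Matrix.diagonal fun p => if blockIdx p = k then 1 else 0

theorem blockProj_posSemidef (k : Fin 3) : (blockProj k).PosSemidef :=
  posSemidef_diagonal_iff.mpr fun p => by split_ifs <;> simp

theorem one_sub_blockProj_posSemidef (k : Fin 3) : (1 - blockProj k).PosSemidef := by
  have : 1 - blockProj k = Matrix.diagonal fun p => if blockIdx p = k then (0 : ℂ) else 1 := by
    rw [blockProj, ← Matrix.diagonal_one, Matrix.diagonal_sub]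
    congr 1
    ext p
    split_ifs <;> simp
  rw [this]
  exact posSemidef_diagonal_iff.mpr fun p => by split_ifs <;> simp

theorem blockState_eq (r c : ℝ) :
    blockState r c = (r ^ 2 / 2 * c) • (1 : Matrix QIdx QIdx ℂ) +
      ((1 + r) * c - r ^ 2 / 2 * c) • blockProj 0 - (r ^ 2 / 2 * c - c) • blockProj 2 := by
  rw [blockState, blockProj, blockProj, ← Matrix.diagonal_one, ← Matrix.diagonal_smul,
    ← Matrix.diagonal_smul, ← Matrix.diagonal_smul, Matrix.diagonal_add, Matrix.diagonal_sub]
  congr 1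
  ext p
  obtain ⟨k, hk⟩ : ∃ k, blockIdx p = k := ⟨_, rfl⟩
  fin_cases k <;> simp [blockEig, hk]

theorem trace_unitary_conj {U : Matrix QIdx QIdx ℂ} (hU : U ∈ Matrix.unitaryGroup QIdx ℂ)
    (M : Matrix QIdx QIdx ℂ) : (U * M * Uᴴ).trace = M.trace := by
  rw [Matrix.mul_assoc, Matrix.trace_mul_comm, Matrix.mul_assoc, ← star_eq_conjTranspose,
    Matrix.mem_unitaryGroup_iff'.mp hU, Matrix.mul_one]

theorem one_sub_unitary_conj {U : Matrix QIdx QIdx ℂ} (hU : U ∈ Matrix.unitaryGroup QIdx ℂ)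
    (M : Matrix QIdx QIdx ℂ) : 1 - U * M * Uᴴ = U * (1 - M) * Uᴴ := by
  rw [Matrix.mul_sub, Matrix.sub_mul, Matrix.mul_one, ← star_eq_conjTranspose,
    Matrix.mem_unitaryGroup_iff.mp hU]

theorem schmidt_quadratic_nonneg {r x y z : ℝ} (hr : 2 ≤ r ^ 2)
    (hr' : 3 * r ^ 2 - 4 * r - 2 ≤ 0) :
    0 ≤ r ^ 2 / 2 * (x ^ 2 + y ^ 2 + z ^ 2) + (1 + r - r ^ 2 / 2) * (-(x * y) - x * z) -
      (r ^ 2 / 2 - 1) * (x ^ 2 + x * y + max (x * z) (y ^ 2)) := by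
  rcases le_total (x * z) (y ^ 2) with h | h
  · rw [max_eq_right h]
    have key : 0 ≤ 2 * r ^ 2 * (r ^ 2 / 2 * (x ^ 2 + y ^ 2 + z ^ 2) +
        (1 + r - r ^ 2 / 2) * (-(x * y) - x * z) -
          (r ^ 2 / 2 - 1) * (x ^ 2 + x * y + y ^ 2)) := by
      linear_combination 2 * mul_nonneg (sq_nonneg r) (sq_nonneg (y - r * x / 2)) +
        sq_nonneg (r ^ 2 * z - (1 + r - r ^ 2 / 2) * x) +
        (1 / 4) * mul_nonneg (mul_nonneg (sub_nonneg.mpr hr) (sub_nonneg.mpr hr')) (sq_nonneg x)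
    exact nonneg_of_mul_nonneg_right key (by linarith)
  · rw [max_eq_left h]
    linear_combination sq_nonneg (x - r * (y + z) / 2) +
      (1 / 4) * mul_nonneg (sq_nonneg r) (sq_nonneg (y - z))

theorem schmidtForm_linear (d : Fin 3 → ℝ) (u v w : ℝ) (M N K : Matrix QIdx QIdx ℂ) :
    schmidtForm d (u • M + v • N - w • K) =
      u * schmidtForm d M + v * schmidtForm d N - w * schmidtForm d K := by
  simp only [schmidtForm, Matrix.sub_apply, Matrix.add_apply, Matrix.smul_apply, Complex.sub_re,
    Complex.add_re, Complex.smul_re, smul_eq_mul, Finset.mul_sum, ← Finset.sum_add_distrib,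
    ← Finset.sum_sub_distrib]
  exact Finset.sum_congr rfl fun s _ => Finset.sum_congr rfl fun t _ => by ring

theorem schmidtForm_one (d : Fin 3 → ℝ) :
    schmidtForm d 1 = d 0 ^ 2 + d 1 ^ 2 + d 2 ^ 2 := by
  simp [schmidtForm, Fin.sum_univ_three, Matrix.one_apply]
  ring

theorem schmidtForm_blockState_nonneg_of_sorted {r c : ℝ} (hc : 0 ≤ c) (hr : 2 ≤ r ^ 2)
    (hr' : 3 * r ^ 2 - 4 * r - 2 ≤ 0) {U : Matrix QIdx QIdx ℂ}
    (hU : U ∈ Matrix.unitaryGroup QIdx ℂ) {d : Fin 3 → ℝ}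
    (h2 : 0 ≤ d 2) (h21 : d 2 ≤ d 1) (h10 : d 1 ≤ d 0) :
    0 ≤ schmidtForm d (U * blockState r c * Uᴴ) := by
  have hps : ∀ k, (U * blockProj k * Uᴴ).PosSemidef := fun k =>
    (blockProj_posSemidef k).mul_mul_conjTranspose_same U
  have hps' : ∀ k, (1 - U * blockProj k * Uᴴ).PosSemidef := fun k => by
    rw [one_sub_unitary_conj hU]
    exact (one_sub_blockProj_posSemidef k).mul_mul_conjTranspose_same U
  have ht0 : (U * blockProj 0 * Uᴴ).trace.re = 2 := by
    have hcard : (Finset.univ.filter fun p => blockIdx p = 0).card = 2 := by decide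
    rw [trace_unitary_conj hU]
    simp [blockProj, Matrix.trace, hcard]
  have ht2 : (U * blockProj 2 * Uᴴ).trace.re = 3 := by
    have hcard : (Finset.univ.filter fun p => blockIdx p = 2).card = 3 := by decide
    rw [trace_unitary_conj hU]
    simp [blockProj, Matrix.trace, hcard]
  have hlo := schmidtForm_ge_of_trace_eq_two (hps 0) (hps' 0) ht0 h2 h21 h10
  have hup := schmidtForm_le_of_trace_eq_three (hps 2) (hps' 2) ht2 h2 h21 h10
  have hdec : U * blockState r c * Uᴴ = (r ^ 2 / 2 * c) • (1 : Matrix QIdx QIdx ℂ) +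
      ((1 + r) * c - r ^ 2 / 2 * c) • (U * blockProj 0 * Uᴴ) -
        (r ^ 2 / 2 * c - c) • (U * blockProj 2 * Uᴴ) := by
    rw [blockState_eq]
    simp only [Matrix.mul_sub, Matrix.mul_add, Matrix.sub_mul, Matrix.add_mul, Matrix.mul_smul,
      Matrix.smul_mul, Matrix.mul_one]
    rw [← star_eq_conjTranspose, Matrix.mem_unitaryGroup_iff.mp hU]
  rw [hdec, schmidtForm_linear, schmidtForm_one]
  have ha : 0 ≤ (1 + r) * c - r ^ 2 / 2 * c := by
    have : 0 ≤ 1 + r - r ^ 2 / 2 := by nlinarith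
    nlinarith [mul_nonneg this hc]
  have hb : 0 ≤ r ^ 2 / 2 * c - c := by nlinarith
  linear_combination mul_nonneg hc (schmidt_quadratic_nonneg (x := d 0) (y := d 1) (z := d 2)
    hr hr') + mul_nonneg ha (sub_nonneg.mpr hlo) + mul_nonneg hb (sub_nonneg.mpr hup)

theorem schmidtForm_blockState_nonneg {r c : ℝ} (hc : 0 ≤ c) (hr : 2 ≤ r ^ 2)
    (hr' : 3 * r ^ 2 - 4 * r - 2 ≤ 0) {U : Matrix QIdx QIdx ℂ}
    (hU : U ∈ Matrix.unitaryGroup QIdx ℂ) {d : Fin 3 → ℝ} (hd : ∀ i, 0 ≤ d i) :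
    0 ≤ schmidtForm d (U * blockState r c * Uᴴ) := by
  let σ : Equiv.Perm (Fin 3) := Fin.revPerm.trans (Tuple.sort d)
  let e : Equiv.Perm QIdx := σ.prodCongr σ
  have hanti : ∀ i j, i ≤ j → d (σ j) ≤ d (σ i) := fun i j hij =>
    Tuple.monotone_sort d (Fin.rev_le_rev.mpr hij)
  have hU' : U.submatrix e id ∈ Matrix.unitaryGroup QIdx ℂ := by
    rw [Matrix.mem_unitaryGroup_iff, star_eq_conjTranspose, conjTranspose_submatrix]
    change U.submatrix e (Equiv.refl _) * Uᴴ.submatrix (Equiv.refl _) e = 1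
    rw [Matrix.submatrix_mul_equiv, ← star_eq_conjTranspose,
      Matrix.mem_unitaryGroup_iff.mp hU, submatrix_one_equiv]
  have h := schmidtForm_blockState_nonneg_of_sorted (d := d ∘ σ) hc hr hr' hU' (hd _)
    (hanti 1 2 (by decide)) (hanti 0 1 (by decide))
  refine h.trans_eq (Eq.symm ?_)
  have hsub : U.submatrix e id * blockState r c * (U.submatrix e id)ᴴ =
      (U * blockState r c * Uᴴ).submatrix e e := rfl
  rw [hsub]
  unfold schmidtForm
  rw [← Equiv.sum_comp σ]
  refine Finset.sum_congr rfl fun s _ => ?_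
  rw [← Equiv.sum_comp σ]
  rfl

theorem PT_isHermitian {M : Matrix QIdx QIdx ℂ} (hM : M.IsHermitian) : (PT M).IsHermitian := by
  ext p q
  exact hM.apply _ _

theorem blockState_mem_AP33 {r c : ℝ} (hc : 0 ≤ c) (hr0 : 0 ≤ r) (hr : 2 ≤ r ^ 2)
    (hr' : 3 * r ^ 2 - 4 * r - 2 ≤ 0) (htr : c * (2 * r ^ 2 + 2 * r + 5) = 1) :
    blockState r c ∈ AP33 := by
  have hpos : (blockState r c).PosSemidef := by
    refine posSemidef_diagonal_iff.mpr fun p => Complex.zero_le_real.mpr ?_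
    generalize blockIdx p = k
    fin_cases k <;> simp [blockEig] <;> positivity
  refine ⟨hpos, ?_, fun U hU => ?_⟩
  · have : (blockState r c).trace = ((c * (2 * r ^ 2 + 2 * r + 5) : ℝ) : ℂ) := by
      simp [blockState, Matrix.trace, Fintype.sum_prod_type, Fin.sum_univ_three, blockIdx,
        blockEig]
      ring
    rw [this, htr, Complex.ofReal_one]
  · have hH := PT_isHermitian (hpos.mul_mul_conjTranspose_same U).isHermitian
    refine .of_dotProduct_mulVec_nonneg hH fun ψ => ?_
    obtain ⟨A, hA, B, hB, d, hd, hψ⟩ :=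
      exists_singular_value_decomposition (Matrix.of fun i j => ψ (i, j))
    have hψ' : ψ = fun p : QIdx => (A * Matrix.diagonal (fun i => (d i : ℂ)) * B) p.1 p.2 := by
      rw [← hψ]
      rfl
    refine Complex.le_def.mpr ⟨?_, (hH.im_star_dotProduct_mulVec_self ψ).symm⟩
    rw [hψ', quadForm_PT_eq]
    set G := kroneckerMap (· * ·) A Bᴴ with hG
    have hGU : Gᴴ * U ∈ Matrix.unitaryGroup QIdx ℂ :=
      mul_mem (Unitary.star_mem (kronecker_conjTranspose_mem_unitaryGroup hA hB)) hU
    refine (schmidtForm_blockState_nonneg hc hr hr' hGU hd).trans_eq ?_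
    rw [schmidtForm, Complex.re_sum]
    refine Finset.sum_congr rfl fun s _ => ?_
    rw [Complex.re_sum]
    refine Finset.sum_congr rfl fun t _ => ?_
    rw [← Complex.ofReal_mul, Complex.re_ofReal_mul, conjTranspose_mul, conjTranspose_conjTranspose]
    simp only [Matrix.mul_assoc]

/-- An orthonormal basis of `3 × 3` real matrices, consisting of symmetric and antisymmetric
matrices. -/
def frame (p : QIdx) : Matrix (Fin 3) (Fin 3) ℝ :=
  let h : ℝ := (√2)⁻¹
  ![![!![0, h, 0; -h, 0, 0; 0, 0, 0], !![0, 0, h; 0, 0, 0; -h, 0, 0],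
      !![0, 0, 0; 0, 0, h; 0, -h, 0]],
    ![!![0, 0, 0; 0, 1, 0; 0, 0, 0], !![0, 0, 0; 0, 0, 0; 0, 0, 1],
      !![0, 0, 0; 0, 0, h; 0, h, 0]],
    ![!![1, 0, 0; 0, 0, 0; 0, 0, 0], !![0, h, 0; h, 0, 0; 0, 0, 0],
      !![0, 0, h; 0, 0, 0; h, 0, 0]]] p.1 p.2

theorem inv_sqrt_two_mul_self : (√2)⁻¹ * (√2)⁻¹ = (1 / 2 : ℝ) := by
  rw [← mul_inv, Real.mul_self_sqrt (by norm_num)]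
  norm_num

theorem frame_orthonormal (m n : QIdx) :
    ∑ i, ∑ j, frame m i j * frame n i j = if m = n then 1 else 0 := by
  obtain ⟨m₁, m₂⟩ := m
  obtain ⟨n₁, n₂⟩ := n
  fin_cases m₁ <;> fin_cases m₂ <;> fin_cases n₁ <;> fin_cases n₂ <;>
    simp [frame, Fin.sum_univ_three, inv_sqrt_two_mul_self] <;> norm_num

/-- The products `F m * diag(r, 1, 1) * F n` of the frame matrices `F`. -/
def frameProd (r : ℝ) (m n : QIdx) (i j : Fin 3) : ℝ :=
  ∑ k, (![r, 1, 1] : Fin 3 → ℝ) k * frame m i k * frame n k j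

/-- The diagonal entries of `frameProd r m m`. -/
def frameDiag (r : ℝ) (m : QIdx) : Fin 3 → ℝ :=
  ![![![-1 / 2, -r / 2, 0], ![-1 / 2, 0, -r / 2], ![0, -1 / 2, -1 / 2]],
    ![![0, 1, 0], ![0, 0, 1], ![0, 1 / 2, 1 / 2]],
    ![![r, 0, 0], ![1 / 2, r / 2, 0], ![1 / 2, 0, r / 2]]] m.1 m.2

theorem frameProd_self (r : ℝ) (m : QIdx) (i j : Fin 3) :
    frameProd r m m i j = if i = j then frameDiag r m i else 0 := by
  obtain ⟨m₁, m₂⟩ := m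
  have hh := inv_sqrt_two_mul_self
  fin_cases m₁ <;> fin_cases m₂ <;> fin_cases i <;> fin_cases j <;>
    simp [frame, frameProd, frameDiag, Fin.sum_univ_three, mul_assoc, hh] <;> ring

theorem sum_blockEig_mul_frameDiag (r c : ℝ) (i : Fin 3) :
    ∑ m, blockEig r c (blockIdx m) * frameDiag r m i = 0 := by
  fin_cases i <;>
    simp [frameDiag, blockEig, blockIdx, Fintype.sum_prod_type, Fin.sum_univ_three] <;> ring

theorem sum_blockEig_mul_frameProd (r c : ℝ) (i j : Fin 3) :
    ∑ m, blockEig r c (blockIdx m) * frameProd r m m i j = 0 := by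
  by_cases h : i = j
  · simpa [frameProd_self, h] using sum_blockEig_mul_frameDiag r c j
  · simp [frameProd_self, h]

/-- The unitary sending standard basis vectors to permuted frame vectors with phases. -/
def frameUnitary (π : Equiv.Perm QIdx) (θ : QIdx → ℂ) : Matrix QIdx QIdx ℂ :=
  Matrix.of fun p m => θ m * frame (π m) p.1 p.2

theorem frameUnitary_mem (π : Equiv.Perm QIdx) {θ : QIdx → ℂ} (hθ : ∀ m, star (θ m) * θ m = 1) :
    frameUnitary π θ ∈ Matrix.unitaryGroup QIdx ℂ := by
  rw [Matrix.mem_unitaryGroup_iff']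
  ext m n
  have h : (star (frameUnitary π θ) * frameUnitary π θ) m n =
      star (θ m) * θ n * ((∑ i, ∑ j, frame (π m) i j * frame (π n) i j : ℝ) : ℂ) := by
    simp only [Matrix.mul_apply, star_eq_conjTranspose, conjTranspose_apply, frameUnitary,
      Matrix.of_apply, Fintype.sum_prod_type, Complex.ofReal_sum, Finset.mul_sum]
    refine Finset.sum_congr rfl fun i _ => Finset.sum_congr rfl fun j _ => ?_
    simp only [star_mul', Complex.star_def, Complex.conj_ofReal, Complex.ofReal_mul]
    ring
  rw [h, frame_orthonormal, Matrix.one_apply]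
  by_cases hmn : m = n
  · subst hmn
    simpa using hθ m
  · simp [hmn]

/-- The vector with Schmidt coefficients `r, 1, 1`. -/
def schmidtVec (r : ℝ) (p : QIdx) : ℂ :=
  if p.1 = p.2 then (((![r, 1, 1] : Fin 3 → ℝ) p.1 : ℝ) : ℂ) else 0

theorem PT_frameUnitary_mulVec (r : ℝ) (π : Equiv.Perm QIdx) (θ : QIdx → ℂ)
    (X : Matrix QIdx QIdx ℂ) (i j : Fin 3) :
    (PT (frameUnitary π θ * X * (frameUnitary π θ)ᴴ) *ᵥ schmidtVec r) (i, j) =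
      ∑ m, ∑ n, X m n * frameProd r (π m) (π n) i j * (θ m * star (θ n)) := by
  have h : ∀ k, (frameUnitary π θ * X * (frameUnitary π θ)ᴴ) (i, k) (k, j) =
      ∑ m, ∑ n, X m n * (frame (π m) i k * frame (π n) k j) * (θ m * star (θ n)) := by
    intro k
    simp only [Matrix.mul_apply, conjTranspose_apply, frameUnitary, Matrix.of_apply,
      Finset.sum_mul]
    rw [Finset.sum_comm]
    refine Finset.sum_congr rfl fun m _ => Finset.sum_congr rfl fun n _ => ?_
    simp only [star_mul', Complex.star_def, Complex.conj_ofReal]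
    ring
  have h' : (PT (frameUnitary π θ * X * (frameUnitary π θ)ᴴ) *ᵥ schmidtVec r) (i, j) =
      ∑ k, (((![r, 1, 1] : Fin 3 → ℝ) k : ℝ) : ℂ) *
        (frameUnitary π θ * X * (frameUnitary π θ)ᴴ) (i, k) (k, j) := by
    simp only [mulVec, dotProduct, PT, schmidtVec, Fintype.sum_prod_type, mul_ite, mul_zero,
      Finset.sum_ite_eq, Finset.mem_univ, if_true]
    exact Finset.sum_congr rfl fun k _ => mul_comm _ _
  simp only [h', h, Finset.mul_sum]
  rw [Finset.sum_comm]
  refine Finset.sum_congr rfl fun m _ => ?_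
  rw [Finset.sum_comm]
  refine Finset.sum_congr rfl fun n _ => ?_
  simp only [frameProd, Complex.ofReal_sum, Finset.mul_sum, Finset.sum_mul, Complex.ofReal_mul]
  exact Finset.sum_congr rfl fun k _ => by ring

theorem PT_blockState_mulVec {r c : ℝ} {π : Equiv.Perm QIdx} {θ : QIdx → ℂ}
    (hπ : ∀ m, blockIdx (π m) = blockIdx m) (hθ : ∀ m, star (θ m) * θ m = 1) :
    PT (frameUnitary π θ * blockState r c * (frameUnitary π θ)ᴴ) *ᵥ schmidtVec r = 0 := by
  ext ⟨i, j⟩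
  have h := sum_blockEig_mul_frameProd r c i j
  rw [← Equiv.sum_comp π] at h
  rw [PT_frameUnitary_mulVec, Pi.zero_apply, ← Complex.ofReal_zero, ← h, Complex.ofReal_sum]
  refine Finset.sum_congr rfl fun m _ => ?_
  rw [Finset.sum_eq_single m (fun n _ hn => by simp [blockState, hn.symm]) (by simp),
    mul_comm (θ m), hθ, hπ]
  simp [blockState]

/-- A kernel vector of a strict convex combination of positive semidefinite matrices is a kernel
vector of each of them. -/
theorem mulVec_eq_zero_of_add {n : Type*} [Fintype n] {M N : Matrix n n ℂ} (hM : M.PosSemidef)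
    (hN : N.PosSemidef) {u v : ℝ} (hu : 0 < u) (hv : 0 < v) {ψ : n → ℂ}
    (h : (u • M + v • N) *ᵥ ψ = 0) : M *ᵥ ψ = 0 := by
  classical
  have h0 : u • (star ψ ⬝ᵥ M *ᵥ ψ) + v • (star ψ ⬝ᵥ N *ᵥ ψ) = 0 := by
    have := congrArg (star ψ ⬝ᵥ ·) h
    simpa [add_mulVec, smul_mulVec, dotProduct_add, dotProduct_smul] using this
  have hM0 := smul_nonneg hu.le (hM.dotProduct_mulVec_nonneg ψ)
  have hN0 := smul_nonneg hv.le (hN.dotProduct_mulVec_nonneg ψ)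
  have := ((add_eq_zero_iff_of_nonneg hM0 hN0).mp h0).1
  rw [← hM.dotProduct_mulVec_zero_iff]
  exact (smul_eq_zero.mp this).resolve_left hu.ne'

theorem PT_conj_add_smul (U X Y : Matrix QIdx QIdx ℂ) (u v : ℝ) :
    PT (U * (u • X + v • Y) * Uᴴ) = u • PT (U * X * Uᴴ) + v • PT (U * Y * Uᴴ) := by
  simp only [Matrix.mul_add, Matrix.add_mul, Matrix.mul_smul, Matrix.smul_mul]
  rfl

/-- The off-diagonal coefficients of a sesquilinear form that vanishes on all vectors of phases
are zero. -/
theorem coeff_eq_zero_of_phases {n : Type*} [Fintype n] [DecidableEq n] {C : n → n → ℂ}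
    (h : ∀ θ : n → ℂ, (∀ m, star (θ m) * θ m = 1) →
      ∑ m, ∑ k, C m k * (θ m * star (θ k)) = 0) {p q : n} (hpq : p ≠ q) : C p q = 0 := by
  let B : (n → ℂ) → (n → ℂ) → ℂ := fun x y => ∑ m, ∑ k, C m k * (x m * star (y k))
  have hadd_left : ∀ x x' y, B (x + x') y = B x y + B x' y := fun x x' y => by
    simp only [B, ← Finset.sum_add_distrib, Pi.add_apply]
    exact Finset.sum_congr rfl fun m _ => Finset.sum_congr rfl fun k _ => by ring
  have hadd_right : ∀ x y y', B x (y + y') = B x y + B x y' := fun x y y' => by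
    simp only [B, ← Finset.sum_add_distrib, Pi.add_apply, star_add]
    exact Finset.sum_congr rfl fun m _ => Finset.sum_congr rfl fun k _ => by ring
  have hsingle : ∀ m k (z w : ℂ), B (Pi.single m z) (Pi.single k w) = C m k * (z * star w) := by
    intro m k z w
    simp only [B]
    rw [Finset.sum_eq_single m (fun i _ hi => by simp [hi]) (by simp),
      Finset.sum_eq_single k (fun i _ hi => by simp [hi]) (by simp)]
    simp
  have hB : ∀ z w : ℂ, star z * z = 1 → star w * w = 1 →
      B (1 + Pi.single p (z - 1) + Pi.single q (w - 1))
        (1 + Pi.single p (z - 1) + Pi.single q (w - 1)) = 0 := by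
    intro z w hz hw
    refine h _ fun m => ?_
    by_cases hmp : m = p
    · subst hmp
      simpa [hpq] using hz
    · by_cases hmq : m = q
      · subst hmq
        simpa [hmp] using hw
      · simp [hmp, hmq]
  have key : ∀ z w : ℂ, star z * z = 1 → star w * w = 1 →
      C p q * ((z - 1) * star (w - 1)) + C q p * ((w - 1) * star (z - 1)) = 0 := by
    intro z w hz hw
    have h1 := hB z w hz hw
    have h2 := hB z 1 hz (by simp)
    have h3 := hB 1 w (by simp) hw
    have h4 := hB 1 1 (by simp) (by simp)
    simp only [sub_self, Pi.single_zero, add_zero, hadd_left, hadd_right, hsingle] at h1 h2 h3 h4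
    linear_combination h1 - h2 - h3 + h4
  have k1 := key (-1) (-1) (by simp) (by simp)
  have k2 := key Complex.I (-1) (by simp) (by simp)
  simp only [star_sub, star_neg, star_one, Complex.star_def, Complex.conj_I] at k1 k2
  have h2I : (16 * Complex.I) * C p q = 0 := by
    linear_combination (-4 : ℂ) * k2 + (2 * Complex.I + 2) * k1
  simpa using h2I

theorem blockIdx_swap {p q : QIdx} (h : blockIdx p = blockIdx q) (x : QIdx) :
    blockIdx (Equiv.swap p q x) = blockIdx x := by
  rcases eq_or_ne x p with rfl | hxp
  · rw [Equiv.swap_apply_left, h]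
  · rcases eq_or_ne x q with rfl | hxq
    · rw [Equiv.swap_apply_right, h]
    · rw [Equiv.swap_apply_of_ne_of_ne hxp hxq]

theorem exists_perm_blockIdx {m n m' n' : QIdx} (hmn : m ≠ n) (hmn' : m' ≠ n')
    (hm : blockIdx m = blockIdx m') (hn : blockIdx n = blockIdx n') :
    ∃ π : Equiv.Perm QIdx, (∀ x, blockIdx (π x) = blockIdx x) ∧ π m = m' ∧ π n = n' := by
  have h1 : Equiv.swap m m' n ≠ m' := fun h =>
    hmn ((Equiv.swap m m').injective ((Equiv.swap_apply_left m m').trans h.symm))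
  refine ⟨(Equiv.swap m m').trans (Equiv.swap (Equiv.swap m m' n) n'), fun x => ?_, ?_, ?_⟩
  · rw [Equiv.trans_apply, blockIdx_swap (by rw [blockIdx_swap hm, hn]), blockIdx_swap hm]
  · rw [Equiv.trans_apply, Equiv.swap_apply_left, Equiv.swap_apply_of_ne_of_ne h1.symm hmn']
  · rw [Equiv.trans_apply, Equiv.swap_apply_left]

theorem exists_frameProd_ne_zero {r : ℝ} (hr : r ≠ 0) (k l : Fin 3) :
    ∃ m n i j, m ≠ n ∧ k = blockIdx m ∧ l = blockIdx n ∧ frameProd r m n i j ≠ 0 := by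
  fin_cases k <;> fin_cases l
  · exact ⟨(0, 0), (0, 1), 1, 2, by decide, by decide, by decide, by
      simp [frameProd, frame, Fin.sum_univ_three, hr]⟩
  · exact ⟨(0, 0), (1, 0), 0, 1, by decide, by decide, by decide, by
      simp [frameProd, frame, Fin.sum_univ_three]⟩
  · exact ⟨(0, 0), (2, 0), 1, 0, by decide, by decide, by decide, by
      simp [frameProd, frame, Fin.sum_univ_three, hr]⟩
  · exact ⟨(1, 0), (0, 0), 1, 0, by decide, by decide, by decide, by
      simp [frameProd, frame, Fin.sum_univ_three]⟩
  · exact ⟨(1, 0), (1, 2), 1, 2, by decide, by decide, by decide, by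
      simp [frameProd, frame, Fin.sum_univ_three]⟩
  · exact ⟨(1, 0), (2, 1), 1, 0, by decide, by decide, by decide, by
      simp [frameProd, frame, Fin.sum_univ_three]⟩
  · exact ⟨(2, 0), (0, 0), 0, 1, by decide, by decide, by decide, by
      simp [frameProd, frame, Fin.sum_univ_three, hr]⟩
  · exact ⟨(2, 1), (1, 0), 0, 1, by decide, by decide, by decide, by
      simp [frameProd, frame, Fin.sum_univ_three]⟩
  · exact ⟨(2, 0), (2, 1), 0, 1, by decide, by decide, by decide, by
      simp [frameProd, frame, Fin.sum_univ_three, hr]⟩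

theorem frameDiag_ne {r : ℝ} (hr : 0 < r) {p q : QIdx} (hpq : p ≠ q)
    (hb : blockIdx p = blockIdx q) : frameDiag r p ≠ frameDiag r q := by
  intro h
  have h1 := congrFun h 1
  have h2 := congrFun h 2
  clear h
  obtain ⟨p₁, p₂⟩ := p
  obtain ⟨q₁, q₂⟩ := q
  revert hpq hb h1 h2
  fin_cases p₁ <;> fin_cases p₂ <;> fin_cases q₁ <;> fin_cases q₂ <;>
    simp [blockIdx, frameDiag, hr.ne'] <;> intros <;> linarith

/-- The kernel conditions force a matrix of trace one to be the given state. -/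
theorem eq_blockState_of_kernel {r c : ℝ} (hr : 0 < r) (htr : c * (2 * r ^ 2 + 2 * r + 5) = 1)
    {X : Matrix QIdx QIdx ℂ} (hX : X.trace = 1)
    (hker : ∀ (π : Equiv.Perm QIdx) (θ : QIdx → ℂ), (∀ m, blockIdx (π m) = blockIdx m) →
      (∀ m, star (θ m) * θ m = 1) →
      PT (frameUnitary π θ * X * (frameUnitary π θ)ᴴ) *ᵥ schmidtVec r = 0) :
    X = blockState r c := by
  have hsum : ∀ (π : Equiv.Perm QIdx) (θ : QIdx → ℂ) (i j : Fin 3),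
      (∀ m, blockIdx (π m) = blockIdx m) → (∀ m, star (θ m) * θ m = 1) →
      ∑ m, ∑ n, X m n * frameProd r (π m) (π n) i j * (θ m * star (θ n)) = 0 :=
    fun π θ i j hπ hθ => by rw [← PT_frameUnitary_mulVec, hker π θ hπ hθ, Pi.zero_apply]
  have hoff : ∀ m n, m ≠ n → X m n = 0 := by
    intro m n hmn
    obtain ⟨m', n', i, j, hmn', hm, hn, hne⟩ :=
      exists_frameProd_ne_zero hr.ne' (blockIdx m) (blockIdx n)
    obtain ⟨π, hπ, rfl, rfl⟩ := exists_perm_blockIdx hmn hmn' hm hn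
    have := coeff_eq_zero_of_phases (fun θ hθ => hsum π θ i j hπ hθ) hmn
    exact (mul_eq_zero.mp this).resolve_right (Complex.ofReal_ne_zero.mpr hne)
  have hdiag : ∀ (π : Equiv.Perm QIdx) (i : Fin 3), (∀ m, blockIdx (π m) = blockIdx m) →
      ∑ m, X m m * frameDiag r (π m) i = 0 := by
    intro π i hπ
    rw [← hsum π 1 i i hπ (by simp)]
    refine Finset.sum_congr rfl fun m _ => ?_
    rw [Finset.sum_eq_single m (fun n _ hn => by simp [hoff m n hn.symm]) (by simp)]
    simp [frameProd_self]
  have hconst : ∀ p q, blockIdx p = blockIdx q → X p p = X q q := by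
    intro p q hb
    by_cases hpq : p = q
    · rw [hpq]
    obtain ⟨i, hi⟩ := Function.ne_iff.mp (frameDiag_ne hr hpq hb)
    have h1 := hdiag 1 i fun _ => rfl
    have h2 := hdiag (Equiv.swap p q) i (blockIdx_swap hb)
    have h3 : ∑ m, X m m * ((frameDiag r m i : ℂ) - frameDiag r (Equiv.swap p q m) i) = 0 := by
      simp only [mul_sub, Finset.sum_sub_distrib, h2, sub_zero]
      exact h1
    rw [Finset.sum_eq_add p q hpq (fun x _ hx => by
      rw [Equiv.swap_apply_of_ne_of_ne hx.1 hx.2, sub_self, mul_zero]) (by simp) (by simp),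
      Equiv.swap_apply_left, Equiv.swap_apply_right] at h3
    have h4 : (X p p - X q q) * ((frameDiag r p i : ℂ) - frameDiag r q i) = 0 := by
      linear_combination h3
    refine sub_eq_zero.mp ((mul_eq_zero.mp h4).resolve_right (sub_ne_zero.mpr ?_))
    exact Complex.ofReal_injective.ne hi
  let y : Fin 3 → ℂ := ![X (0, 0) (0, 0), X (1, 0) (1, 0), X (2, 0) (2, 0)]
  have hy : ∀ p, X p p = y (blockIdx p) := by
    intro p
    obtain ⟨k, hk⟩ : ∃ k, blockIdx p = k := ⟨_, rfl⟩
    rw [hk]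
    fin_cases k
    · exact hconst p (0, 0) hk
    · exact hconst p (1, 0) hk
    · exact hconst p (2, 0) hk
  have e0 := hdiag 1 0 fun _ => rfl
  have e1 := hdiag 1 1 fun _ => rfl
  have e2 : ∑ m, X m m = 1 := hX
  simp only [hy] at e0 e1 e2
  clear_value y
  simp [Fintype.sum_prod_type, Fin.sum_univ_three, blockIdx, frameDiag] at e0 e1 e2
  have htr' : (c : ℂ) * (2 * r ^ 2 + 2 * r + 5) = 1 := by exact_mod_cast htr
  have hα : y 0 = (1 + r) * y 2 := by linear_combination -e0
  have hβ : y 1 = r ^ 2 / 2 * y 2 := by linear_combination e1 + r / 2 * hα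
  have hγ : y 2 = c := by
    linear_combination c * e2 - 2 * c * hα - 4 * c * hβ - y 2 * htr'
  ext p q
  by_cases hpq : p = q
  · subst hpq
    rw [hy, blockState, Matrix.diagonal_apply_eq]
    generalize blockIdx p = k
    fin_cases k <;> simp [blockEig, hα, hβ, hγ]
  · rw [hoff p q hpq, blockState, Matrix.diagonal_apply_ne _ hpq]

theorem blockState_mem_extremePoints {r c : ℝ} (hc : 0 ≤ c) (hr0 : 0 < r) (hr : 2 ≤ r ^ 2)
    (hr' : 3 * r ^ 2 - 4 * r - 2 ≤ 0) (htr : c * (2 * r ^ 2 + 2 * r + 5) = 1) :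
    blockState r c ∈ Set.extremePoints ℝ AP33 := by
  rw [mem_extremePoints_iff_left]
  refine ⟨blockState_mem_AP33 hc hr0.le hr hr' htr, fun X hX Y hY ⟨u, v, hu, hv, _, huv⟩ => ?_⟩
  refine eq_blockState_of_kernel hr0 htr hX.2.1 fun π θ hπ hθ => ?_
  have hU := frameUnitary_mem π hθ
  refine mulVec_eq_zero_of_add (hX.2.2 _ hU) (hY.2.2 _ hU) hu hv ?_
  rw [← PT_conj_add_smul, huv]
  exact PT_blockState_mulVec hπ hθ

theorem sqrt_two_le_of_lt {r c : ℝ} (hc : 0 < c) (hr : 0 < r)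
    (htr : c * (2 * r ^ 2 + 2 * r + 5) = 1) (h : c < (9 - 2 * √2) / 73) : √2 ≤ r := by
  have h22 : √2 ^ 2 = 2 := Real.sq_sqrt (by norm_num)
  by_contra! hlt
  have hsq : r ^ 2 ≤ √2 ^ 2 := pow_le_pow_left₀ hr.le hlt.le 2
  have hm : 2 * r ^ 2 + 2 * r + 5 ≤ 9 + 2 * √2 := by linarith
  have h3 := mul_lt_mul_of_pos_right h (by positivity : 0 < 9 + 2 * √2)
  have h4 := mul_le_mul_of_nonneg_left hm hc.le
  have h5 : (9 - 2 * √2) / 73 * (9 + 2 * √2) = 1 := by linear_combination (-4 / 73) * h22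
  linarith

theorem le_of_le_of_sqrt_ten {r c : ℝ} (hc : 0 < c)
    (htr : c * (2 * r ^ 2 + 2 * r + 5) = 1) (h : (85 - 14 * √10) / 585 ≤ c) :
    r ≤ (2 + √10) / 3 := by
  have h10 : √10 ^ 2 = 10 := Real.sq_sqrt (by norm_num)
  by_contra! hlt
  have hsq : ((2 + √10) / 3) ^ 2 < r ^ 2 := pow_lt_pow_left₀ hlt (by positivity) two_ne_zero
  have hm : (85 + 14 * √10) / 9 < 2 * r ^ 2 + 2 * r + 5 := by linarith
  have h3 := mul_le_mul_of_nonneg_right h (by positivity : 0 ≤ (85 + 14 * √10) / 9)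
  have h4 := mul_lt_mul_of_pos_left hm hc
  have h5 : (85 - 14 * √10) / 585 * ((85 + 14 * √10) / 9) = 1 := by
    linear_combination (-196 / 5265) * h10
  linarith

/-- for (85−14√10)/585 ≤ c < (9−2√2)/73, the state
diag(a, a, b, b, b, b, c, c, c) with a = (c + √(2c − 9c²))/2 and
b = (1 − 4c − √(2c − 9c²))/4 is extreme in AP_{3,3}. -/
theorem nu243_extreme (c : ℝ)
    (h1 : (85 - 14 * Real.sqrt 10) / 585 ≤ c) (h2 : c < (9 - 2 * Real.sqrt 2) / 73) :
    diag9 ![(c + Real.sqrt (2 * c - 9 * c ^ 2)) / 2, (c + Real.sqrt (2 * c - 9 * c ^ 2)) / 2,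
        (1 - 4 * c - Real.sqrt (2 * c - 9 * c ^ 2)) / 4,
        (1 - 4 * c - Real.sqrt (2 * c - 9 * c ^ 2)) / 4,
        (1 - 4 * c - Real.sqrt (2 * c - 9 * c ^ 2)) / 4,
        (1 - 4 * c - Real.sqrt (2 * c - 9 * c ^ 2)) / 4, c, c, c]
      ∈ Set.extremePoints ℝ AP33 := by
  have h10 : √10 ^ 2 = 10 := Real.sq_sqrt (by norm_num)
  have h_ten_lt : √10 < 3.2 := by
    rw [Real.sqrt_lt' (by norm_num)]
    norm_num
  have h_ten_gt : 2 < √10 := Real.lt_sqrt_of_sq_lt (by norm_num)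
  have h22 : √2 ^ 2 = 2 := Real.sq_sqrt (by norm_num)
  have h_two_gt : 1.4 < √2 := Real.lt_sqrt_of_sq_lt (by norm_num)
  have hc : 0 < c := lt_of_lt_of_le (by linarith) h1
  have hc' : c < 0.1 := h2.trans (by linarith)
  set s := √(2 * c - 9 * c ^ 2) with hs
  have hs2 : s ^ 2 = 2 * c - 9 * c ^ 2 := Real.sq_sqrt (by nlinarith)
  have hsc : c < s := Real.lt_sqrt_of_sq_lt (by nlinarith)
  obtain ⟨r, hr⟩ : ∃ r, r = (s - c) / (2 * c) := ⟨_, rfl⟩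
  have hr0 : 0 < r := hr ▸ div_pos (by linarith) (by linarith)
  have hsr : s = (2 * r + 1) * c := by
    rw [hr]
    field_simp
    ring
  have htr : c * (2 * r ^ 2 + 2 * r + 5) = 1 := by
    have : 2 * c * (c * (2 * r ^ 2 + 2 * r + 5) - 1) = 0 := by
      rw [hsr] at hs2
      linear_combination hs2
    have := (mul_eq_zero.mp this).resolve_left (by positivity)
    linarith
  have hlow : √2 ≤ r := sqrt_two_le_of_lt hc hr0 htr h2
  have hup : r ≤ (2 + √10) / 3 := le_of_le_of_sqrt_ten hc htr h1
  have hdiag : diag9 ![(c + s) / 2, (c + s) / 2, (1 - 4 * c - s) / 4, (1 - 4 * c - s) / 4,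
      (1 - 4 * c - s) / 4, (1 - 4 * c - s) / 4, c, c, c] = blockState r c := by
    have ha : (c + s) / 2 = (1 + r) * c := by
      rw [hsr]
      ring
    have hb : (1 - 4 * c - s) / 4 = r ^ 2 / 2 * c := by
      rw [hsr]
      linear_combination (-1 / 4) * htr
    rw [ha, hb, diag9, blockState]
    congr 1
    ext ⟨i, j⟩
    fin_cases i <;> fin_cases j <;> rfl
  rw [hdiag]
  refine blockState_mem_extremePoints hc.le hr0 ?_ ?_ htr
  · rw [← h22]
    exact pow_le_pow_left₀ (Real.sqrt_nonneg 2) hlow 2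
  · have hpos : 0 ≤ r - (2 - √10) / 3 := by linarith
    linear_combination 3 * mul_nonneg (sub_nonneg.mpr hup) hpos + (1 / 3) * h10
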